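/- arXiv:2305.02850 — 2 statements merged into one kernel-verified Lean document; each statement's English description precedes it below -/
import Mathlib

section
/- Let k = 2d for an integer d ≥ 2, let n ≥ 1 be an integer, and let p : ℕ → ℕ be any function. There exists ε₀ > 0 such that for every ε ∈ (0, ε₀): the partition C of X(n,ε,d) into the 2d ε-balls has k-median cost 2nkd·ε; this is the optimal k-median cost of X(n,ε,d) over all partitions into at most k clusters; and every partition of X(n,ε,d) into at most k clusters other than C has k-median cost at least p(4nd²) times the k-median cost of C. -/
noncomputable section

attribute [local instance] Classical.propDecidable

/-- A threshold decision tree over `ℝ^d`: every internal node is labeled by a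
coordinate index and a real threshold. -/
inductive TDT (d : ℕ) : Type
  | leaf : TDT d
  | node (r : Fin d) (θ : ℝ) (left right : TDT d) : TDT d

namespace TDT

/-- The number of leaves of a threshold decision tree. -/
def leaves {d : ℕ} : TDT d → ℕ
  | leaf => 1
  | node _ _ l r => l.leaves + r.leaves

/-- The depth of a threshold decision tree: the maximum number of internal nodes
on a root-to-leaf path. -/
def depth {d : ℕ} : TDT d → ℕ
  | leaf => 0
  | node _ _ l r => max l.depth r.depth + 1

/-- The index (numbering leaves from left to right) of the leaf a point is routed to:
at a node labeled `(r, θ)` the point goes left when its `r`-th coordinate is `< θ`,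
and right otherwise. -/
def route {d : ℕ} : TDT d → EuclideanSpace ℝ (Fin d) → ℕ
  | leaf, _ => 0
  | node r θ l rt, x => if x r < θ then l.route x else l.leaves + rt.route x

/-- The clustering of a finite multiset induced by a threshold decision tree:
the partition of `X` into the nonempty fibers of `route` (points routed to the
same leaf form one cluster). -/
def clustering {d : ℕ} (t : TDT d) (X : Multiset (EuclideanSpace ℝ (Fin d))) :
    Multiset (Multiset (EuclideanSpace ℝ (Fin d))) :=
  Multiset.filter (fun C => C ≠ 0)
    ((Finset.range t.leaves).val.map fun i => X.filter fun x => t.route x = i)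

end TDT

/-- `P` is a partition of the multiset `X` into at most `k` nonempty clusters. -/
def IsClustering {d : ℕ} (X : Multiset (EuclideanSpace ℝ (Fin d))) (k : ℕ)
    (P : Multiset (Multiset (EuclideanSpace ℝ (Fin d)))) : Prop :=
  P.sum = X ∧ Multiset.card P ≤ k ∧ (0 : Multiset (EuclideanSpace ℝ (Fin d))) ∉ P

/-- The `1`-means cost of a single cluster: `inf_c Σ_{x ∈ C} ‖x - c‖²`. -/
def costMeans1 {d : ℕ} (C : Multiset (EuclideanSpace ℝ (Fin d))) : ℝ :=
  ⨅ c : EuclideanSpace ℝ (Fin d), (C.map fun x => ‖x - c‖ ^ 2).sum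

/-- The k-means cost of a partition. -/
def costMeans {d : ℕ} (P : Multiset (Multiset (EuclideanSpace ℝ (Fin d)))) : ℝ :=
  (P.map costMeans1).sum

/-- The `1`-median cost of a single cluster: `inf_c Σ_{x ∈ C} ‖x - c‖`. -/
def costMedian1 {d : ℕ} (C : Multiset (EuclideanSpace ℝ (Fin d))) : ℝ :=
  ⨅ c : EuclideanSpace ℝ (Fin d), (C.map fun x => ‖x - c‖).sum

/-- The k-median cost of a partition. -/
def costMedian {d : ℕ} (P : Multiset (Multiset (EuclideanSpace ℝ (Fin d)))) : ℝ :=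
  (P.map costMedian1).sum

/-- The `1`-center cost of a single cluster: `inf_c max_{x ∈ C} ‖x - c‖`. -/
def costCenter1 {d : ℕ} (C : Multiset (EuclideanSpace ℝ (Fin d))) : ℝ :=
  ⨅ c : EuclideanSpace ℝ (Fin d), sSup ((fun x => ‖x - c‖) '' {x | x ∈ C})

/-- The k-center cost of a partition: the maximum over clusters of the `1`-center cost. -/
def costCenter {d : ℕ} (P : Multiset (Multiset (EuclideanSpace ℝ (Fin d)))) : ℝ :=
  sSup (costCenter1 '' {C | C ∈ P})

/-- The optimal k-means cost of `X` over all partitions into at most `k` clusters. -/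
def optMeans {d : ℕ} (X : Multiset (EuclideanSpace ℝ (Fin d))) (k : ℕ) : ℝ :=
  sInf {r : ℝ | ∃ P, IsClustering X k P ∧ r = costMeans P}

/-- The optimal k-median cost of `X` over all partitions into at most `k` clusters. -/
def optMedian {d : ℕ} (X : Multiset (EuclideanSpace ℝ (Fin d))) (k : ℕ) : ℝ :=
  sInf {r : ℝ | ∃ P, IsClustering X k P ∧ r = costMedian P}

/-- The optimal k-center cost of `X` over all partitions into at most `k` clusters. -/
def optCenter {d : ℕ} (X : Multiset (EuclideanSpace ℝ (Fin d))) (k : ℕ) : ℝ :=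
  sInf {r : ℝ | ∃ P, IsClustering X k P ∧ r = costCenter P}

/-! ### The high-dimensional point-set `X(n, ε, d)` -/

/-- The sign `1` or `-1` encoded by a boolean. -/
def sgn (b : Bool) : ℝ := if b then 1 else -1

/-- The point `a·e_i + ε·b·e_j` (with signs `a, b` encoded by booleans). -/
def hdPoint (d : ℕ) (ε : ℝ) (i j : Fin d) (a b : Bool) : EuclideanSpace ℝ (Fin d) :=
  EuclideanSpace.single i (sgn a) + EuclideanSpace.single j (ε * sgn b)

/-- The ε-ball `B_i^a`: `n` copies of `a·e_i + ε·b·e_j` for all `j` and signs `b`. -/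
def epsBall (n d : ℕ) (ε : ℝ) (i : Fin d) (a : Bool) : Multiset (EuclideanSpace ℝ (Fin d)) :=
  (Finset.univ : Finset (Fin d × Bool)).val.bind fun jb =>
    Multiset.replicate n (hdPoint d ε i jb.1 a jb.2)

/-- The partition `C` of `X(n, ε, d)` into the `2d` ε-balls `B_i^a`. -/
def XhdPartition (n d : ℕ) (ε : ℝ) : Multiset (Multiset (EuclideanSpace ℝ (Fin d))) :=
  (Finset.univ : Finset (Fin d × Bool)).val.map fun ia => epsBall n d ε ia.1 ia.2

/-- The multiset `X(n, ε, d)`: `n` copies of `a·e_i + ε·b·e_j` for all `i, j ∈ [d]`,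
`a, b ∈ {1, -1}`; it has `4nd²` points counted with multiplicity. -/
def Xhd (n d : ℕ) (ε : ℝ) : Multiset (EuclideanSpace ℝ (Fin d)) :=
  (XhdPartition n d ε).sum

/-! ### The weighted planar point-set `X(w, h)` -/

/-- A pair of reals viewed as a point of the Euclidean plane. -/
def toE2 (q : ℝ × ℝ) : EuclideanSpace ℝ (Fin 2) :=
  (WithLp.equiv 2 (Fin 2 → ℝ)).symm ![q.1, q.2]

/-- `planarP h i = (p_i^1, p_i^2)`, the two points of the `i`-th cluster of the
weighted planar point-set `X(w, h)` (positions depend only on `h`). -/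
def planarP (h : ℕ → ℝ) : ℕ → (ℝ × ℝ) × (ℝ × ℝ)
  | 0 => ((0, 0), (0, 0))
  | 1 => ((0, 0), (0, 0))
  | 2 => ((h 2, 0), (h 2, 0))
  | i + 3 =>
      let q := planarP h (i + 1)
      let q' := planarP h (i + 2)
      if (i + 3) % 2 = 1 then
        ((q.1.1 - 1, q.1.2 + h (i + 3)), (q'.2.1 + 1, q.2.2 + h (i + 3)))
      else
        ((q.1.1 + h (i + 3), q.1.2 - 1), (q.2.1 + h (i + 3), q'.2.2 + 1))

/-- The position of the weighted point indexed by `(i, a) : Fin k × Fin 2`,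
i.e. `p_{i+1}^{a+1}`. -/
def wpt (k : ℕ) (h : ℕ → ℝ) (x : Fin k × Fin 2) : EuclideanSpace ℝ (Fin 2) :=
  toE2 (if x.2 = (0 : Fin 2) then (planarP h ((x.1 : ℕ) + 1)).1
        else (planarP h ((x.1 : ℕ) + 1)).2)

/-- `P` is a partition of the index set of the `2k` weighted points into at most `k`
nonempty clusters. -/
def IsIdxPartition (k : ℕ) (P : Finset (Finset (Fin k × Fin 2))) : Prop :=
  P.card ≤ k ∧ (∀ S ∈ P, S.Nonempty) ∧
    ∀ x : Fin k × Fin 2, ∃! S : Finset (Fin k × Fin 2), S ∈ P ∧ x ∈ S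

/-- The weighted k-means cost of a partition of the index set of `X(w, h)`. -/
def wCostMeans (k : ℕ) (h w : ℕ → ℝ) (P : Finset (Finset (Fin k × Fin 2))) : ℝ :=
  ∑ S ∈ P, ⨅ c : EuclideanSpace ℝ (Fin 2),
    ∑ x ∈ S, w ((x.1 : ℕ) + 1) * ‖wpt k h x - c‖ ^ 2

/-- The weighted k-median cost of a partition of the index set of `X(w, h)`. -/
def wCostMedian (k : ℕ) (h w : ℕ → ℝ) (P : Finset (Finset (Fin k × Fin 2))) : ℝ :=
  ∑ S ∈ P, ⨅ c : EuclideanSpace ℝ (Fin 2),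
    ∑ x ∈ S, w ((x.1 : ℕ) + 1) * ‖wpt k h x - c‖

/-- The minimum weighted k-means cost over all partitions of the `2k` weighted points
into at most `k` clusters. -/
def wOptMeans (k : ℕ) (h w : ℕ → ℝ) : ℝ :=
  sInf {r : ℝ | ∃ P, IsIdxPartition k P ∧ r = wCostMeans k h w P}

/-- The minimum weighted k-median cost over all partitions of the `2k` weighted points
into at most `k` clusters. -/
def wOptMedian (k : ℕ) (h w : ℕ → ℝ) : ℝ :=
  sInf {r : ℝ | ∃ P, IsIdxPartition k P ∧ r = wCostMedian k h w P}

/-- The canonical partition `C = (C_1, …, C_k)` of the index set, where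
`C_i = {p_i^1, p_i^2}`. -/
def wCanonical (k : ℕ) : Finset (Finset (Fin k × Fin 2)) :=
  (Finset.univ : Finset (Fin k)).image fun i =>
    Finset.univ.filter fun x : Fin k × Fin 2 => x.1 = i

/-- The partition of the index set of the `2k` weighted points induced by a threshold
decision tree (nonempty fibers of the routing of the corresponding positions). -/
def treeIdxPartition (k : ℕ) (t : TDT 2) (h : ℕ → ℝ) : Finset (Finset (Fin k × Fin 2)) :=
  Finset.filter (fun S => S.Nonempty)
    ((Finset.range t.leaves).image fun ℓ =>
      Finset.univ.filter fun x : Fin k × Fin 2 => t.route (wpt k h x) = ℓ)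

/-! ### The planar point-set `Y_k` for k-center -/

/-- The four points of the first cluster of `Y_k`. -/
def Ybase1 : Fin 4 → ℝ × ℝ := ![(-1, 0), (-1.5, 0.5), (-1, 1), (-0.5, 0.5)]

/-- The four points of the second cluster of `Y_k`. -/
def Ybase2 : Fin 4 → ℝ × ℝ := ![(1, 0), (0.5, 0.5), (1, 1), (1.5, 0.5)]

/-- `Ypt i a = p_i^{a+1}`, the `a`-th point of the `i`-th cluster of `Y_k`. -/
def Ypt : ℕ → Fin 4 → ℝ × ℝ
  | 0, _ => (0, 0)
  | 1, a => Ybase1 a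
  | 2, a => Ybase2 a
  | 3, a => Ybase1 a + (1, 2)
  | 4, a => Ybase2 a + (2, 1)
  | i + 5, a => Ypt (i + 3) a + (2, 2)

/-- The cluster `C_i = {p_i^1, p_i^2, p_i^3, p_i^4}` of `Y_k`. -/
def Ycluster (i : ℕ) : Multiset (EuclideanSpace ℝ (Fin 2)) :=
  (Finset.univ : Finset (Fin 4)).val.map fun a => toE2 (Ypt i a)

/-- The partition `C = (C_1, …, C_k)` of `Y_k`. -/
def Ypartition (k : ℕ) : Multiset (Multiset (EuclideanSpace ℝ (Fin 2))) :=
  (Finset.range k).val.map fun i => Ycluster (i + 1)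

/-- The point-set `Y_k` (as a multiset of `4k` points in the plane). -/
def Yset (k : ℕ) : Multiset (EuclideanSpace ℝ (Fin 2)) := (Ypartition k).sum


lemma mem_sum_iff_exists_mem {α : Type*} {P : Multiset (Multiset α)} {x : α} :
    x ∈ P.sum ↔ ∃ C ∈ P, x ∈ C :=
  Multiset.mem_join

/-- If `P` and the nonempty blocks `Q i` have the same sum, the `Q i` are separated by disjoint
predicates `R i`, every member of `P` lies in one `R i`, and `P` has no more members than there are
blocks, then `P` consists exactly of the blocks. -/
lemma eq_map_of_separated {α ι : Type*} [Fintype ι] (P : Multiset (Multiset α))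
    (Q : ι → Multiset α) (R : ι → α → Prop)
    (hR : ∀ i j x, R i x → R j x → i = j) (hQR : ∀ i, ∀ x ∈ Q i, R i x) (hQ : ∀ i, Q i ≠ 0)
    (hsum : P.sum = ((Finset.univ : Finset ι).val.map Q).sum)
    (hcard : Multiset.card P ≤ Fintype.card ι)
    (hP : ∀ C ∈ P, ∃ i, ∀ x ∈ C, R i x) :
    P = (Finset.univ : Finset ι).val.map Q := by
  rcases isEmpty_or_nonempty ι with hι | hι
  · have h0 : Multiset.card P = 0 := by simpa using hcard
    rw [Multiset.card_eq_zero] at h0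
    subst h0
    simp
  have hP' : ∀ C, ∃ i, C ∈ P → ∀ x ∈ C, R i x := by
    intro C
    by_cases hC : C ∈ P
    · obtain ⟨i, hi⟩ := hP C hC
      exact ⟨i, fun _ => hi⟩
    · exact ⟨Classical.arbitrary ι, fun h => absurd h hC⟩
  choose f hf using hP'
  have hle : (Finset.univ : Finset ι).val ≤ P.map f := by
    rw [Multiset.le_iff_subset Finset.univ.nodup]
    intro i _
    obtain ⟨x, hx⟩ := Multiset.exists_mem_of_ne_zero (hQ i)
    have hxs : x ∈ P.sum := by
      rw [hsum, mem_sum_iff_exists_mem]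
      exact ⟨Q i, Multiset.mem_map_of_mem Q (Finset.mem_univ i), hx⟩
    obtain ⟨C, hC, hxC⟩ := mem_sum_iff_exists_mem.1 hxs
    exact Multiset.mem_map.2 ⟨C, hC, hR _ _ x (hf C hC x hxC) (hQR i x hx)⟩
  have hmap : (Finset.univ : Finset ι).val = P.map f :=
    Multiset.eq_of_le_of_card_le hle (by simpa using hcard)
  have hnd : (P.map f).Nodup := hmap ▸ Finset.univ.nodup
  have key : ∀ C ∈ P, Q (f C) = C := by
    intro C hC
    have h1 : P.sum.filter (R (f C)) = C := by
      obtain ⟨P', hP'⟩ := Multiset.exists_cons_of_mem hC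
      rw [hP', Multiset.map_cons, Multiset.nodup_cons] at hnd
      rw [hP', Multiset.sum_cons, Multiset.filter_add, Multiset.filter_eq_self.2 (hf C hC),
        Multiset.filter_eq_nil.2, add_zero]
      intro x hx hRx
      obtain ⟨C', hC', hxC'⟩ := mem_sum_iff_exists_mem.1 hx
      have hmem : C' ∈ P := hP' ▸ Multiset.mem_cons_of_mem hC'
      exact hnd.1 (Multiset.mem_map.2 ⟨C', hC', hR _ _ x (hf C' hmem x hxC') hRx⟩)
    have hmemU : f C ∈ (Finset.univ : Finset ι).val := Finset.mem_univ _
    have h2 : ((Finset.univ : Finset ι).val.map Q).sum.filter (R (f C)) = Q (f C) := by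
      obtain ⟨U, hU⟩ := Multiset.exists_cons_of_mem hmemU
      have hndU := (Finset.univ : Finset ι).nodup
      rw [hU, Multiset.nodup_cons] at hndU
      rw [hU, Multiset.map_cons, Multiset.sum_cons, Multiset.filter_add,
        Multiset.filter_eq_self.2 (hQR _), Multiset.filter_eq_nil.2, add_zero]
      intro x hx hRx
      obtain ⟨C', hC', hxC'⟩ := mem_sum_iff_exists_mem.1 hx
      obtain ⟨j, hj, rfl⟩ := Multiset.mem_map.1 hC'
      have hji := hR _ _ x (hQR j x hxC') hRx
      exact hndU.1 (hji ▸ hj)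
    rw [← h2, ← hsum, h1]
  rw [hmap, Multiset.map_map]
  conv_lhs => rw [← Multiset.map_id P]
  exact Multiset.map_congr rfl fun C hC => (key C hC).symm

lemma sum_norm_sub_nonneg {d : ℕ} (C : Multiset (EuclideanSpace ℝ (Fin d)))
    (c : EuclideanSpace ℝ (Fin d)) : 0 ≤ (C.map fun x => ‖x - c‖).sum := by
  apply Multiset.sum_nonneg
  intro r hr
  obtain ⟨x, _, rfl⟩ := Multiset.mem_map.1 hr
  exact norm_nonneg _

lemma costMedian1_nonneg {d : ℕ} (C : Multiset (EuclideanSpace ℝ (Fin d))) :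
    0 ≤ costMedian1 C :=
  Real.iInf_nonneg (sum_norm_sub_nonneg C)

lemma costMedian1_le_costMedian {d : ℕ} {P : Multiset (Multiset (EuclideanSpace ℝ (Fin d)))}
    {C : Multiset (EuclideanSpace ℝ (Fin d))} (hC : C ∈ P) : costMedian1 C ≤ costMedian P := by
  apply Multiset.single_le_sum
  · intro r hr
    obtain ⟨D, _, rfl⟩ := Multiset.mem_map.1 hr
    exact costMedian1_nonneg D
  · exact Multiset.mem_map_of_mem _ hC

lemma dist_le_costMedian1 {d : ℕ} {C : Multiset (EuclideanSpace ℝ (Fin d))}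
    {x y : EuclideanSpace ℝ (Fin d)} (hx : x ∈ C) (hy : y ∈ C) :
    dist x y ≤ costMedian1 C := by
  rcases eq_or_ne x y with rfl | hne
  · simpa using costMedian1_nonneg C
  obtain ⟨D, rfl⟩ := Multiset.exists_cons_of_mem hx
  obtain ⟨E, rfl⟩ := Multiset.exists_cons_of_mem
    ((Multiset.mem_cons.1 hy).resolve_left hne.symm)
  apply le_ciInf
  intro c
  simp only [Multiset.map_cons, Multiset.sum_cons]
  have h1 := dist_triangle_right x y c
  rw [dist_eq_norm x c, dist_eq_norm y c] at h1
  have h2 := sum_norm_sub_nonneg E c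
  linarith

lemma mem_epsBall {n d : ℕ} {ε : ℝ} {i : Fin d} {a : Bool} {x : EuclideanSpace ℝ (Fin d)}
    (hx : x ∈ epsBall n d ε i a) : ∃ j b, x = hdPoint d ε i j a b := by
  obtain ⟨jb, _, h⟩ := Multiset.mem_bind.1 hx
  exact ⟨jb.1, jb.2, Multiset.eq_of_mem_replicate h⟩

lemma epsBall_ne_zero {n d : ℕ} (hn : 1 ≤ n) (ε : ℝ) (i : Fin d) (a : Bool) :
    epsBall n d ε i a ≠ 0 := by
  intro h
  have : hdPoint d ε i i a true ∈ epsBall n d ε i a :=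
    Multiset.mem_bind.2 ⟨(i, true), Finset.mem_univ _, Multiset.mem_replicate.2 ⟨by omega, rfl⟩⟩
  simp [h] at this

lemma abs_sgn (b : Bool) : |sgn b| = 1 := by
  cases b <;> simp [sgn]

lemma dist_center_le_of_mem_epsBall {n d : ℕ} {ε : ℝ} (hε : 0 < ε) {i : Fin d} {a : Bool}
    {x : EuclideanSpace ℝ (Fin d)} (hx : x ∈ epsBall n d ε i a) :
    dist x (EuclideanSpace.single i (sgn a)) ≤ ε := by
  obtain ⟨j, b, rfl⟩ := mem_epsBall hx
  simp [hdPoint, dist_eq_norm, abs_sgn, abs_of_pos hε]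

lemma one_le_dist_centers {d : ℕ} {p q : Fin d × Bool} (hpq : p ≠ q) :
    1 ≤ dist (EuclideanSpace.single p.1 (sgn p.2) : EuclideanSpace ℝ (Fin d))
      (EuclideanSpace.single q.1 (sgn q.2)) := by
  obtain ⟨i, a⟩ := p
  obtain ⟨j, b⟩ := q
  rw [dist_eq_norm]
  refine le_trans ?_ (PiLp.norm_apply_le _ i)
  by_cases hij : i = j
  · subst hij
    cases a <;> cases b <;> simp_all [sgn] <;> norm_num
  · simp [hij, abs_sgn]

lemma sum_map_epsBall (n d : ℕ) (ε : ℝ) (i : Fin d) (a : Bool)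
    (g : EuclideanSpace ℝ (Fin d) → ℝ) :
    ((epsBall n d ε i a).map g).sum =
      n * ∑ j : Fin d, (g (hdPoint d ε i j a true) + g (hdPoint d ε i j a false)) := by
  rw [epsBall, Multiset.map_bind, Multiset.sum_bind]
  simp only [Multiset.map_replicate, Multiset.sum_replicate, nsmul_eq_mul]
  change ∑ jb : Fin d × Bool, (n : ℝ) * g (hdPoint d ε i jb.1 a jb.2) = _
  rw [← Finset.mul_sum, Fintype.sum_prod_type]
  simp

lemma costMedian1_epsBall (n d : ℕ) {ε : ℝ} (hε : 0 < ε) (i : Fin d) (a : Bool) :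
    costMedian1 (epsBall n d ε i a) = 2 * n * d * ε := by
  apply le_antisymm
  · refine (ciInf_le ⟨0, ?_⟩ (EuclideanSpace.single i (sgn a))).trans ?_
    · rintro _ ⟨c, rfl⟩
      exact sum_norm_sub_nonneg _ c
    · rw [sum_map_epsBall]
      simp only [hdPoint, add_sub_cancel_left, PiLp.norm_single, norm_mul,
        Real.norm_eq_abs, abs_sgn, abs_of_pos hε, Finset.sum_const, Finset.card_univ,
        Fintype.card_fin, nsmul_eq_mul]
      apply le_of_eq
      ring
  · apply le_ciInf
    intro c
    rw [sum_map_epsBall]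
    have h : ∀ j : Fin d, 2 * ε ≤
        ‖hdPoint d ε i j a true - c‖ + ‖hdPoint d ε i j a false - c‖ := by
      intro j
      have h1 := norm_sub_le (hdPoint d ε i j a true - c) (hdPoint d ε i j a false - c)
      refine le_trans (le_of_eq ?_) h1
      have h2 : hdPoint d ε i j a true - c - (hdPoint d ε i j a false - c) =
          EuclideanSpace.single j (2 * ε) := by
        ext l
        by_cases hl : l = j
        · simp [hdPoint, sgn, hl]
          ring
        · simp [hdPoint, sgn, hl]
      rw [h2, PiLp.norm_single, Real.norm_eq_abs, abs_of_pos (by linarith)]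
    have h3 := Finset.sum_le_sum fun j (_ : j ∈ (Finset.univ : Finset (Fin d))) => h j
    simp only [Finset.sum_const, Finset.card_univ, Fintype.card_fin, nsmul_eq_mul] at h3
    have h4 := mul_le_mul_of_nonneg_left h3 (Nat.cast_nonneg (α := ℝ) n)
    linarith

lemma costMedian_XhdPartition (n d : ℕ) {ε : ℝ} (hε : 0 < ε) :
    costMedian (XhdPartition n d ε) = ((2 * n * (2 * d) * d : ℕ) : ℝ) * ε := by
  rw [costMedian, XhdPartition, Multiset.map_map]
  simp only [Function.comp_def, costMedian1_epsBall n d hε, Multiset.map_const',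
    Multiset.sum_replicate, Finset.card_val, Finset.card_univ, Fintype.card_prod,
    Fintype.card_fin, Fintype.card_bool, nsmul_eq_mul]
  push_cast
  ring

lemma isClustering_XhdPartition {n : ℕ} (hn : 1 ≤ n) (d : ℕ) (ε : ℝ) :
    IsClustering (Xhd n d ε) (2 * d) (XhdPartition n d ε) := by
  refine ⟨rfl, ?_, ?_⟩
  · simp [XhdPartition, mul_comm]
  · intro h
    obtain ⟨p, _, hp⟩ := Multiset.mem_map.1 h
    exact epsBall_ne_zero hn ε p.1 p.2 hp

/-- A clustering other than the one into ε-balls merges points of two distinct ε-balls, and hence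
costs at least `1 / 2`. -/
lemma half_le_costMedian_of_ne {n d : ℕ} (hn : 1 ≤ n) {ε : ℝ} (hε : 0 < ε) (hε' : ε < 1 / 4)
    {P : Multiset (Multiset (EuclideanSpace ℝ (Fin d)))}
    (hP : IsClustering (Xhd n d ε) (2 * d) P) (hne : P ≠ XhdPartition n d ε) :
    1 / 2 ≤ costMedian P := by
  by_cases hmono : ∀ C ∈ P, ∃ q : Fin d × Bool, ∀ x ∈ C,
      dist x (EuclideanSpace.single q.1 (sgn q.2)) ≤ ε
  · refine absurd (eq_map_of_separated P (fun q : Fin d × Bool => epsBall n d ε q.1 q.2)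
      (fun q x => dist x (EuclideanSpace.single q.1 (sgn q.2)) ≤ ε) ?_
      (fun q x hx => dist_center_le_of_mem_epsBall hε hx)
      (fun q => epsBall_ne_zero hn ε q.1 q.2) hP.1 ?_ hmono) hne
    · intro p q x hp hq
      by_contra hpq
      have h1 := one_le_dist_centers hpq
      have h2 := dist_triangle_left (EuclideanSpace.single p.1 (sgn p.2))
        (EuclideanSpace.single q.1 (sgn q.2)) x
      linarith
    · simpa [mul_comm] using hP.2.1
  · push Not at hmono
    obtain ⟨C, hC, hsplit⟩ := hmono
    have hball : ∀ x ∈ C, ∃ q : Fin d × Bool, x ∈ epsBall n d ε q.1 q.2 := by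
      intro x hx
      have hxX : x ∈ Xhd n d ε := hP.1 ▸ mem_sum_iff_exists_mem.2 ⟨C, hC, hx⟩
      obtain ⟨B, hB, hxB⟩ := mem_sum_iff_exists_mem.1 hxX
      obtain ⟨q, _, rfl⟩ := Multiset.mem_map.1 hB
      exact ⟨q, hxB⟩
    obtain ⟨x, hx⟩ := Multiset.exists_mem_of_ne_zero fun h : C = 0 => hP.2.2 (h ▸ hC)
    obtain ⟨p, hp⟩ := hball x hx
    obtain ⟨y, hy, hyp⟩ := hsplit p
    obtain ⟨q, hq⟩ := hball y hy
    have hxp := dist_center_le_of_mem_epsBall hε hp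
    have hyq := dist_center_le_of_mem_epsBall hε hq
    have hpq : p ≠ q := by
      rintro rfl
      exact hyp.not_ge hyq
    have h1 := one_le_dist_centers hpq
    have h2 := dist_triangle4 (EuclideanSpace.single p.1 (sgn p.2)) x y
      (EuclideanSpace.single q.1 (sgn q.2))
    rw [dist_comm _ x] at h2
    have h3 := (dist_le_costMedian1 hx hy).trans (costMedian1_le_costMedian hC)
    linarith

/-- STATEMENT: optimality of the ε-ball partition of `X(n, ε, d)` and the cost of any
other partition, for the k-median objective (`k = 2d`). -/
theorem stmt_4 (d n : ℕ) (hd : 2 ≤ d) (hn : 1 ≤ n) (p : ℕ → ℕ) :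
    ∃ ε₀ : ℝ, 0 < ε₀ ∧ ∀ ε : ℝ, 0 < ε → ε < ε₀ →
      costMedian (XhdPartition n d ε) = ((2 * n * (2 * d) * d : ℕ) : ℝ) * ε ∧
      optMedian (Xhd n d ε) (2 * d) = costMedian (XhdPartition n d ε) ∧
      ∀ P, IsClustering (Xhd n d ε) (2 * d) P → P ≠ XhdPartition n d ε →
        (p (4 * n * d ^ 2) : ℝ) * costMedian (XhdPartition n d ε) ≤ costMedian P := by
  set K : ℝ := ((2 * n * (2 * d) * d : ℕ) : ℝ) with hK
  have hK0 : 0 ≤ K := Nat.cast_nonneg _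
  set M : ℝ := ((p (4 * n * d ^ 2) : ℝ) + 1) * K with hM
  have hp0 : (0 : ℝ) ≤ p (4 * n * d ^ 2) := Nat.cast_nonneg _
  have hM0 : 0 ≤ M := by positivity
  refine ⟨min (1 / 4) (1 / (2 * (M + 1))), by positivity, ?_⟩
  intro ε hε hε₀
  have hε1 : ε < 1 / 4 := hε₀.trans_le (min_le_left _ _)
  have hε2 : ε < 1 / (2 * (M + 1)) := hε₀.trans_le (min_le_right _ _)
  have hMε : M * ε ≤ 1 / 2 := by
    rw [lt_div_iff₀ (by positivity)] at hε2
    nlinarith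
  have hcost := costMedian_XhdPartition n d hε
  rw [← hK] at hcost
  have hother : ∀ P, IsClustering (Xhd n d ε) (2 * d) P → P ≠ XhdPartition n d ε →
      ((p (4 * n * d ^ 2) : ℝ) + 1) * (K * ε) ≤ costMedian P := by
    intro P hP hne
    have h := half_le_costMedian_of_ne hn hε hε1 hP hne
    rw [← mul_assoc]
    exact hMε.trans h
  have hKε : 0 ≤ K * ε := by positivity
  refine ⟨hcost, ?_, ?_⟩
  · refine IsLeast.csInf_eq ⟨⟨_, isClustering_XhdPartition hn d ε, rfl⟩, ?_⟩
    rintro _ ⟨P, hP, rfl⟩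
    by_cases hne : P = XhdPartition n d ε
    · rw [hne]
    · have h := hother P hP hne
      rw [hcost]
      nlinarith
  · intro P hP hne
    have h := hother P hP hne
    rw [hcost]
    linarith
end
end

section
/- For every integer k ≥ 3 and every function p : ℕ → ℕ, there exist sequences h_1,…,h_k and w_1,…,w_k of positive reals such that the weighted planar point-set X(w,h) satisfies: (i) some threshold decision tree over ℝ² with k leaves and depth k−1 induces on X(w,h) a clustering whose weighted k-median cost equals the minimum weighted k-median cost over all partitions of the 2k weighted points into at most k clusters; and (ii) every threshold decision tree over ℝ² with k leaves and depth at most k−2 induces on X(w,h) a clustering whose weighted k-median cost is at least p(2k) times that minimum. -/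
noncomputable section

attribute [local instance] Classical.propDecidable

namespace TDT

theorem route_lt_leaves {d : ℕ} (t : TDT d) (x : EuclideanSpace ℝ (Fin d)) :
    t.route x < t.leaves := by
  induction t with
  | leaf => simp [route, leaves]
  | node r θ l rt ihl ihr =>
    simp only [route, leaves]
    split_ifs <;> omega

/-- If two points are routed to the same leaf, they go to the same side of the root. -/
theorem lt_iff_of_route_eq {d : ℕ} {r : Fin d} {θ : ℝ} {l rt : TDT d}
    {x y : EuclideanSpace ℝ (Fin d)}
    (hxy : (node r θ l rt).route x = (node r θ l rt).route y) : x r < θ ↔ y r < θ := by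
  have hx := l.route_lt_leaves x
  have hy := l.route_lt_leaves y
  simp only [route] at hxy
  split_ifs at hxy with h1 h2 h2
  · simp [h1, h2]
  · omega
  · omega
  · simp [h1, h2]

/-- Suppose that in every coordinate, one of the segments `m`, `m + 1` spans all the segments
`1, …, m`. Then a tree that separates the segments `1, …, m` from each other without cutting
any of them has depth at least `m - 1`. -/
theorem le_depth_of_separates {d : ℕ} (P Q : ℕ → EuclideanSpace ℝ (Fin d))
    (hspan : ∀ m, 1 ≤ m → ∀ r, ∃ j, 1 ≤ j ∧ j ≤ m + 1 ∧ ∀ i, 1 ≤ i → i ≤ m →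
      P j r ≤ P i r ∧ P i r ≤ Q i r ∧ Q i r ≤ Q j r)
    (m : ℕ) (t : TDT d)
    (hsame : ∀ i, 1 ≤ i → i ≤ m → t.route (P i) = t.route (Q i))
    (hsep : ∀ i j, 1 ≤ i → i < j → j ≤ m → t.route (P i) ≠ t.route (P j)) :
    m ≤ t.depth + 1 := by
  induction m generalizing t with
  | zero => omega
  | succ m ih =>
    rcases Nat.eq_zero_or_pos m with rfl | hm
    · omega
    cases t with
    | leaf => exact absurd rfl (hsep 1 2 le_rfl (by norm_num) (by omega))
    | node r θ l rt =>
      obtain ⟨j, hj1, hjm, hj⟩ := hspan m hm r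
      have hcut := lt_iff_of_route_eq (hsame j hj1 hjm)
      by_cases hθ : P j r < θ
      · have hQ := hcut.1 hθ
        have hl : ∀ i, 1 ≤ i → i ≤ m → P i r < θ ∧ Q i r < θ := fun i h1 h2 => by
          obtain ⟨a, b, c⟩ := hj i h1 h2
          constructor <;> linarith
        have key := ih l
          (fun i h1 h2 => by
            have := hsame i h1 (by omega)
            simpa [route, (hl i h1 h2).1, (hl i h1 h2).2] using this)
          (fun i i' h1 h2 h3 => by
            have := hsep i i' h1 h2 (by omega)
            simpa [route, (hl i h1 (by omega)).1, (hl i' (by omega) h3).1] using this)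
        simp only [depth]
        omega
      · have hr : ∀ i, 1 ≤ i → i ≤ m → ¬ P i r < θ ∧ ¬ Q i r < θ := fun i h1 h2 => by
          obtain ⟨a, b, c⟩ := hj i h1 h2
          rw [not_lt] at hθ
          constructor <;> rw [not_lt] <;> linarith
        have key := ih rt
          (fun i h1 h2 => by
            have := hsame i h1 (by omega)
            simpa only [route, (hr i h1 h2).1, (hr i h1 h2).2, if_false,
              Nat.add_left_cancel_iff] using this)
          (fun i i' h1 h2 h3 => by
            have := hsep i i' h1 h2 (by omega)
            simpa only [route, (hr i h1 (by omega)).1, (hr i' (by omega) h3).1, if_false,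
              ne_eq, Nat.add_left_cancel_iff] using this)
        simp only [depth]
        omega

/-- The caterpillar tree with `m + 1` leaves, whose nodes `(c j, θ j)` for `j = m + 1, …, 2` are
met in this order along the leftmost path. -/
def caterpillar {d : ℕ} (c : ℕ → Fin d) (θ : ℕ → ℝ) : ℕ → TDT d
  | 0 => leaf
  | m + 1 => node (c (m + 2)) (θ (m + 2)) (caterpillar c θ m) leaf

theorem leaves_caterpillar {d : ℕ} (c : ℕ → Fin d) (θ : ℕ → ℝ) (m : ℕ) :
    (caterpillar c θ m).leaves = m + 1 := by
  induction m with
  | zero => rfl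
  | succ m ih => simp [caterpillar, leaves, ih]

theorem depth_caterpillar {d : ℕ} (c : ℕ → Fin d) (θ : ℕ → ℝ) (m : ℕ) :
    (caterpillar c θ m).depth = m := by
  induction m with
  | zero => rfl
  | succ m ih => simp [caterpillar, depth, ih]

theorem route_caterpillar {d : ℕ} (c : ℕ → Fin d) (θ : ℕ → ℝ) (m i : ℕ)
    (x : EuclideanSpace ℝ (Fin d)) (hi : i ≤ m) (hx : 1 ≤ i → θ (i + 1) ≤ x (c (i + 1)))
    (hlt : ∀ j, i < j → j ≤ m → x (c (j + 1)) < θ (j + 1)) :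
    (caterpillar c θ m).route x = i := by
  induction m with
  | zero => simp only [caterpillar, route]; omega
  | succ m ih =>
    rcases hi.eq_or_lt with rfl | hlt'
    · simp [caterpillar, route, not_lt.2 (hx (by omega)), leaves_caterpillar]
    · rw [caterpillar, route, if_pos (hlt (m + 1) hlt' le_rfl)]
      exact ih (by omega) fun j h1 h2 => hlt j h1 (by omega)

end TDT

/-- The sum of `h j` over the `2 ≤ j ≤ i` with the parity of `r`: the common `r`-th coordinate
of the cluster `i` of `X(w, h)` when `i` has the parity of `r`. -/
def axisSum (h : ℕ → ℝ) (r : Fin 2) (i : ℕ) : ℝ :=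
  ∑ j ∈ Finset.Icc 2 i, if j % 2 = r then h j else 0

/-- The coordinate shared by the two points of the cluster `i` of `X(w, h)`. -/
def axis (i : ℕ) : Fin 2 := ⟨i % 2, Nat.mod_lt _ two_pos⟩

theorem axisSum_succ (h : ℕ → ℝ) (r : Fin 2) {i : ℕ} (hi : 1 ≤ i) :
    axisSum h r (i + 1) = axisSum h r i + if (i + 1) % 2 = r then h (i + 1) else 0 := by
  rw [axisSum, axisSum, ← Finset.insert_Icc_right_eq_Icc_add_one (by omega),
    Finset.sum_insert (by simp)]
  ring

theorem axisSum_one (h : ℕ → ℝ) (r : Fin 2) : axisSum h r 1 = 0 := by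
  simp [axisSum]

theorem axisSum_mono {h : ℕ → ℝ} (hh : ∀ i, 0 ≤ h i) (r : Fin 2) : Monotone (axisSum h r) := by
  intro i j hij
  refine Finset.sum_le_sum_of_subset_of_nonneg (Finset.Icc_subset_Icc_right hij) ?_
  intro l _ _
  split_ifs
  · exact hh l
  · exact le_rfl

theorem axisSum_nonneg {h : ℕ → ℝ} (hh : ∀ i, 0 ≤ h i) (r : Fin 2) (i : ℕ) :
    0 ≤ axisSum h r i := by
  refine Finset.sum_nonneg fun l _ => ?_
  split_ifs
  · exact hh l
  · exact le_rfl

/-- The offset `p_i^2` has with respect to the neighbouring cluster. -/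
def tip (i : ℕ) : ℝ := if i ≤ 2 then 0 else 1

theorem tip_mono : Monotone tip := by
  intro i j hij
  simp only [tip]
  split_ifs <;> first | omega | norm_num

theorem tip_nonneg (i : ℕ) : 0 ≤ tip i := by
  simp only [tip]; split_ifs <;> norm_num

theorem tip_le_one (i : ℕ) : tip i ≤ 1 := by
  simp only [tip]; split_ifs <;> norm_num

theorem planarP_eq (h : ℕ → ℝ) (i : ℕ) (hi : 1 ≤ i) :
    planarP h i =
      if i % 2 = 1 then
        ((-(((i - 1) / 2 : ℕ) : ℝ), axisSum h 1 i), (axisSum h 0 i + tip i, axisSum h 1 i))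
      else
        ((axisSum h 0 i, -(((i - 1) / 2 : ℕ) : ℝ)), (axisSum h 0 i, axisSum h 1 i + tip i)) := by
  induction i using Nat.strong_induction_on with
  | _ i ih =>
    match i, hi with
    | 1, _ => simp [planarP, axisSum_one, tip]
    | 2, _ => simp [planarP, axisSum_succ, axisSum_one, tip]
    | i + 3, _ =>
      have h1 := ih (i + 1) (by omega) (by omega)
      have h2 := ih (i + 2) (by omega) (by omega)
      have hd : ((i + 3 - 1) / 2 : ℕ) = ((i + 1 - 1) / 2 : ℕ) + 1 := by omega
      have ht : tip (i + 3) = 1 := by simp [tip]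
      rw [planarP, hd, ht]
      rcases Nat.mod_two_eq_zero_or_one i with hp | hp
      · have e1 : (i + 1) % 2 = 1 := by omega
        have e2 : (i + 2) % 2 = 0 := by omega
        have e3 : (i + 3) % 2 = 1 := by omega
        simp [h1, h2, e1, e2, e3, axisSum_succ]
        ring
      · have e1 : (i + 1) % 2 = 0 := by omega
        have e2 : (i + 2) % 2 = 1 := by omega
        have e3 : (i + 3) % 2 = 0 := by omega
        simp [h1, h2, e1, e2, e3, axisSum_succ]
        ring

/-- The point `p_i^1` of the plane. -/
def lowPt (h : ℕ → ℝ) (i : ℕ) : EuclideanSpace ℝ (Fin 2) := toE2 (planarP h i).1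

/-- The point `p_i^2` of the plane. -/
def highPt (h : ℕ → ℝ) (i : ℕ) : EuclideanSpace ℝ (Fin 2) := toE2 (planarP h i).2

theorem toE2_zero (q : ℝ × ℝ) : toE2 q 0 = q.1 := rfl

theorem toE2_one (q : ℝ × ℝ) : toE2 q 1 = q.2 := rfl

theorem lowPt_apply (h : ℕ → ℝ) (i : ℕ) (hi : 1 ≤ i) (r : Fin 2) :
    lowPt h i r = if r = axis i then axisSum h r i else -(((i - 1) / 2 : ℕ) : ℝ) := by
  rcases Nat.mod_two_eq_zero_or_one i with hp | hp <;> fin_cases r <;>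
    simp [lowPt, toE2_zero, toE2_one, planarP_eq h i hi, axis, hp]

theorem highPt_apply (h : ℕ → ℝ) (i : ℕ) (hi : 1 ≤ i) (r : Fin 2) :
    highPt h i r = if r = axis i then axisSum h r i else axisSum h r i + tip i := by
  rcases Nat.mod_two_eq_zero_or_one i with hp | hp <;> fin_cases r <;>
    simp [highPt, toE2_zero, toE2_one, planarP_eq h i hi, axis, hp]

theorem wpt_eq (k : ℕ) (h : ℕ → ℝ) (x : Fin k × Fin 2) :
    wpt k h x = if x.2 = 0 then lowPt h (x.1 + 1) else highPt h (x.1 + 1) := by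
  unfold wpt lowPt highPt
  split_ifs <;> rfl

theorem wpt_apply_axis (k : ℕ) (h : ℕ → ℝ) (x : Fin k × Fin 2) :
    wpt k h x (axis (x.1 + 1)) = axisSum h (axis (x.1 + 1)) (x.1 + 1) := by
  rw [wpt_eq]
  split_ifs
  · simp [lowPt_apply]
  · simp [highPt_apply]

theorem wpt_apply_le (k : ℕ) {h : ℕ → ℝ} (hh : ∀ i, 0 ≤ h i) (x : Fin k × Fin 2) (r : Fin 2) :
    wpt k h x r ≤ axisSum h r (x.1 + 1) + 1 := by
  have h0 := axisSum_nonneg hh r (x.1 + 1)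
  have h1 := tip_le_one (x.1 + 1)
  have h2 : (0 : ℝ) ≤ ((x.1 + 1 - 1) / 2 : ℕ) := Nat.cast_nonneg _
  rw [wpt_eq]
  split_ifs
  · rw [lowPt_apply _ _ (by omega)]
    split_ifs <;> linarith
  · rw [highPt_apply _ _ (by omega)]
    split_ifs <;> linarith

theorem axisSum_axis_succ (h : ℕ → ℝ) {i : ℕ} (hi : 1 ≤ i) :
    axisSum h (axis (i + 1)) (i + 1) = axisSum h (axis (i + 1)) i + h (i + 1) := by
  rw [axisSum_succ h _ hi]
  simp [axis]

/-- A cluster lies far beyond all the previous ones along its axis. -/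
theorem wpt_add_le_wpt (k : ℕ) {h : ℕ → ℝ} (hh : ∀ i, 0 ≤ h i) {x y : Fin k × Fin 2}
    (hxy : x.1 < y.1) :
    wpt k h x (axis (y.1 + 1)) + (h (y.1 + 1) - 1) ≤ axisSum h (axis (y.1 + 1)) (y.1 + 1) := by
  have h1 := wpt_apply_le k hh x (axis (y.1 + 1))
  have hlt : (x.1 : ℕ) < y.1 := hxy
  have h2 := axisSum_mono hh (axis (y.1 + 1)) (show (x.1 : ℕ) + 1 ≤ y.1 by omega)
  have h3 := axisSum_axis_succ h (show 1 ≤ (y.1 : ℕ) by omega)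
  linarith

theorem le_norm_wpt_sub (k : ℕ) {h : ℕ → ℝ} (hh : ∀ i, 0 ≤ h i) {x y : Fin k × Fin 2}
    (hxy : x.1 < y.1) : h (y.1 + 1) - 1 ≤ ‖wpt k h x - wpt k h y‖ := by
  have h1 := wpt_add_le_wpt k hh hxy
  have h2 := PiLp.norm_apply_le (wpt k h x - wpt k h y) (axis (y.1 + 1))
  rw [PiLp.sub_apply, wpt_apply_axis, Real.norm_eq_abs] at h2
  linarith [neg_abs_le (wpt k h x (axis (y.1 + 1)) - axisSum h (axis (y.1 + 1)) (y.1 + 1))]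

/-- In each coordinate, one of the clusters `m`, `m + 1` spans all the clusters `1, …, m`. -/
theorem exists_spanning_cluster {h : ℕ → ℝ} (hh : ∀ i, 0 ≤ h i) (m : ℕ) (hm : 1 ≤ m)
    (r : Fin 2) : ∃ j, 1 ≤ j ∧ j ≤ m + 1 ∧ ∀ i, 1 ≤ i → i ≤ m →
      lowPt h j r ≤ lowPt h i r ∧ lowPt h i r ≤ highPt h i r ∧ highPt h i r ≤ highPt h j r := by
  obtain ⟨j, hj, hmj, hjm⟩ : ∃ j, r ≠ axis j ∧ m ≤ j ∧ j ≤ m + 1 := by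
    by_cases hr : r = axis m
    · refine ⟨m + 1, ?_, by omega, by omega⟩
      rw [hr, axis, axis, ne_eq, Fin.mk.injEq]
      omega
    · exact ⟨m, hr, by omega, by omega⟩
  refine ⟨j, by omega, hjm, fun i hi him => ?_⟩
  have hij : i ≤ j := by omega
  have h1 := axisSum_mono hh r hij
  have h2 := axisSum_nonneg hh r i
  have h3 := tip_nonneg i
  have h4 := tip_mono hij
  have h5 : (((i - 1) / 2 : ℕ) : ℝ) ≤ ((j - 1) / 2 : ℕ) := by
    exact_mod_cast Nat.div_le_div_right (by omega)
  have h6 : (0 : ℝ) ≤ ((i - 1) / 2 : ℕ) := Nat.cast_nonneg _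
  rw [lowPt_apply h j (by omega), highPt_apply h j (by omega), lowPt_apply h i hi,
    highPt_apply h i hi, if_neg hj, if_neg hj]
  split_ifs <;> refine ⟨?_, ?_, ?_⟩ <;> linarith

theorem axisSum_le_sum_range {h : ℕ → ℝ} (hh : ∀ i, 0 ≤ h i) {r : Fin 2} {i : ℕ}
    (hr : r ≠ axis i) : axisSum h r i ≤ ∑ j ∈ Finset.range i, h j := by
  rw [axisSum, ← Finset.sum_filter]
  refine Finset.sum_le_sum_of_subset_of_nonneg (fun j hj => ?_) fun j _ _ => hh j
  simp only [Finset.mem_filter, Finset.mem_Icc] at hj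
  rw [Finset.mem_range]
  refine lt_of_le_of_ne hj.1.2 ?_
  rintro rfl
  exact hr (Fin.ext hj.2.symm)

theorem norm_highPt_sub_lowPt_le {h : ℕ → ℝ} (hh : ∀ i, 0 ≤ h i) (i : ℕ) (hi : 1 ≤ i) :
    ‖highPt h i - lowPt h i‖ ≤ ∑ j ∈ Finset.range i, (h j + 1) := by
  obtain ⟨r, hr⟩ : ∃ r : Fin 2, r ≠ axis i := exists_ne _
  have hv : highPt h i - lowPt h i =
      EuclideanSpace.single r (axisSum h r i + tip i + ((i - 1) / 2 : ℕ)) := by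
    ext s
    rw [PiLp.sub_apply, highPt_apply h i hi, lowPt_apply h i hi, PiLp.single_apply]
    by_cases hs : s = axis i
    · simp [hs, hr.symm]
    · have hsr : s = r := by omega
      simp [hsr, hr]
  have h1 := axisSum_le_sum_range hh hr
  have h2 := axisSum_nonneg hh r i
  have h3 := tip_nonneg i
  have h4 : (0 : ℝ) ≤ ((i - 1) / 2 : ℕ) := Nat.cast_nonneg _
  have h5 : (((i - 1) / 2 : ℕ) : ℝ) + 1 ≤ i := by
    have : (i - 1) / 2 + 1 ≤ i := by omega
    exact_mod_cast this
  rw [hv, PiLp.norm_single, Real.norm_of_nonneg (by linarith), Finset.sum_add_distrib]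
  simp only [Finset.sum_const, Finset.card_range, nsmul_eq_mul, mul_one]
  linarith [tip_le_one i]

theorem isIdxPartition_treeIdxPartition (k : ℕ) (t : TDT 2) (h : ℕ → ℝ) (ht : t.leaves ≤ k) :
    IsIdxPartition k (treeIdxPartition k t h) := by
  refine ⟨?_, fun S hS => (Finset.mem_filter.1 hS).2, fun x => ?_⟩
  · refine (Finset.card_filter_le _ _).trans (Finset.card_image_le.trans ?_)
    simpa using ht
  · refine ⟨Finset.univ.filter fun y => t.route (wpt k h y) = t.route (wpt k h x), ?_, ?_⟩
    · simp only [treeIdxPartition, Finset.mem_filter, Finset.mem_image, Finset.mem_range,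
        Finset.mem_univ, and_true]
      exact ⟨⟨_, t.route_lt_leaves _, rfl⟩, x, by simp⟩
    · rintro S ⟨hS, hx⟩
      simp only [treeIdxPartition, Finset.mem_filter, Finset.mem_image] at hS
      obtain ⟨⟨l, -, rfl⟩, -⟩ := hS
      simp only [Finset.mem_filter, Finset.mem_univ, true_and] at hx
      rw [hx]

theorem mem_wCanonical (k : ℕ) (S : Finset (Fin k × Fin 2)) :
    S ∈ wCanonical k ↔ ∃ i, S = Finset.univ.filter fun x : Fin k × Fin 2 => x.1 = i := by
  simp [wCanonical, eq_comm]

theorem isIdxPartition_wCanonical (k : ℕ) : IsIdxPartition k (wCanonical k) := by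
  refine ⟨Finset.card_image_le.trans (by simp), fun S hS => ?_, fun x => ?_⟩
  · obtain ⟨i, rfl⟩ := (mem_wCanonical k S).1 hS
    exact ⟨(i, 0), by simp⟩
  · refine ⟨_, ⟨(mem_wCanonical k _).2 ⟨x.1, rfl⟩, by simp⟩, ?_⟩
    rintro S ⟨hS, hx⟩
    obtain ⟨i, rfl⟩ := (mem_wCanonical k S).1 hS
    simp only [Finset.mem_filter, Finset.mem_univ, true_and] at hx
    rw [hx]

/-- A partition into at most `k` clusters none of which mixes different indices is the
canonical one. -/
theorem IsIdxPartition.eq_wCanonical {k : ℕ} {P : Finset (Finset (Fin k × Fin 2))}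
    (hP : IsIdxPartition k P) (hpure : ∀ S ∈ P, ∀ x ∈ S, ∀ y ∈ S, x.1 = y.1) :
    P = wCanonical k := by
  obtain ⟨hcard, -, hex⟩ := hP
  choose f hf huniq using hex
  set g : Fin k → Finset (Fin k × Fin 2) := fun i => f (i, 0) with hg
  have hinj : Function.Injective g := fun i j hij =>
    hpure (g i) (hf (i, 0)).1 (i, 0) (hf (i, 0)).2 (j, 0) (by rw [hij]; exact (hf (j, 0)).2)
  have himg : Finset.univ.image g = P := by
    refine Finset.eq_of_subset_of_card_le ?_ ?_
    · intro S hS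
      obtain ⟨i, -, rfl⟩ := Finset.mem_image.1 hS
      exact (hf (i, 0)).1
    · rw [Finset.card_image_of_injective _ hinj]
      simpa using hcard
  have hfib : ∀ i, g i = Finset.univ.filter fun x : Fin k × Fin 2 => x.1 = i := by
    intro i
    ext x
    simp only [Finset.mem_filter, Finset.mem_univ, true_and]
    constructor
    · exact fun hx => hpure (g i) (hf (i, 0)).1 x hx (i, 0) (hf (i, 0)).2
    · intro hx
      have hfx := (hf x).1
      rw [← himg] at hfx
      obtain ⟨j, -, hj⟩ := Finset.mem_image.1 hfx
      have hxj : x ∈ g j := by rw [hj]; exact (hf x).2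
      have := hpure (g j) (hf (j, 0)).1 x hxj (j, 0) (hf (j, 0)).2
      rwa [← hx, this]
  rw [← himg, wCanonical]
  simp_rw [← hfib]

theorem wCostMedian_wCanonical_le (k : ℕ) (h w : ℕ → ℝ) (hw : ∀ i, 0 ≤ w i) :
    wCostMedian k h w (wCanonical k) ≤
      ∑ i : Fin k, w (i + 1) * ‖highPt h (i + 1) - lowPt h (i + 1)‖ := by
  rw [wCostMedian, wCanonical, Finset.sum_image]
  · refine Finset.sum_le_sum fun i _ => ?_
    refine (ciInf_le ⟨0, ?_⟩ (lowPt h (i + 1))).trans ?_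
    · rintro _ ⟨c, rfl⟩
      exact Finset.sum_nonneg fun x _ => mul_nonneg (hw _) (norm_nonneg _)
    · have : (Finset.univ.filter fun x : Fin k × Fin 2 => x.1 = i) = {(i, 0), (i, 1)} := by
        ext ⟨a, b⟩
        fin_cases b <;> simp
      rw [this, Finset.sum_pair (by simp)]
      simp [wpt_eq]
  · intro i _ j _ hij
    have : (i, (0 : Fin 2)) ∈ Finset.univ.filter fun x : Fin k × Fin 2 => x.1 = j := by
      have hij' : (Finset.univ.filter fun x : Fin k × Fin 2 => x.1 = i) =
        Finset.univ.filter fun x : Fin k × Fin 2 => x.1 = j := hij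
      rw [← hij']; simp
    simpa using this

/-- A partition with a cluster that mixes different indices is expensive. -/
theorem le_wCostMedian_of_mixed (k : ℕ) (h w : ℕ → ℝ) (hw : ∀ i, 0 ≤ w i)
    {P : Finset (Finset (Fin k × Fin 2))} {S : Finset (Fin k × Fin 2)} (hS : S ∈ P)
    {x y : Fin k × Fin 2} (hx : x ∈ S) (hy : y ∈ S) (hne : x ≠ y)
    (hwxy : w (y.1 + 1) ≤ w (x.1 + 1)) :
    w (y.1 + 1) * ‖wpt k h x - wpt k h y‖ ≤ wCostMedian k h w P := by
  have hterm : ∀ (c : EuclideanSpace ℝ (Fin 2)) (z : Fin k × Fin 2),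
      0 ≤ w (z.1 + 1) * ‖wpt k h z - c‖ := fun c z => mul_nonneg (hw _) (norm_nonneg _)
  refine le_trans ?_ (Finset.single_le_sum (f := fun S : Finset (Fin k × Fin 2) =>
    ⨅ c : EuclideanSpace ℝ (Fin 2), ∑ x ∈ S, w ((x.1 : ℕ) + 1) * ‖wpt k h x - c‖)
    (fun S _ => Real.iInf_nonneg fun c => Finset.sum_nonneg fun z _ => hterm c z) hS)
  refine le_ciInf fun c => ?_
  have hsub : ({x, y} : Finset (Fin k × Fin 2)) ⊆ S := by
    intro z hz
    rcases Finset.mem_insert.1 hz with rfl | hz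
    · exact hx
    · rw [Finset.mem_singleton.1 hz]; exact hy
  calc w (y.1 + 1) * ‖wpt k h x - wpt k h y‖
      ≤ w (y.1 + 1) * (‖wpt k h x - c‖ + ‖wpt k h y - c‖) := by
        refine mul_le_mul_of_nonneg_left ?_ (hw _)
        rw [norm_sub_rev (wpt k h y) c]
        exact norm_sub_le_norm_sub_add_norm_sub _ _ _
    _ ≤ w (x.1 + 1) * ‖wpt k h x - c‖ + w (y.1 + 1) * ‖wpt k h y - c‖ := by
        rw [mul_add]
        gcongr
    _ = ∑ z ∈ ({x, y} : Finset (Fin k × Fin 2)), w (z.1 + 1) * ‖wpt k h z - c‖ := by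
        rw [Finset.sum_pair hne]
    _ ≤ _ := Finset.sum_le_sum_of_subset_of_nonneg hsub fun z _ _ => hterm c z

theorem treeIdxPartition_eq_wCanonical {k : ℕ} {t : TDT 2} {h : ℕ → ℝ} (ht : t.leaves = k)
    (hroute : ∀ x : Fin k × Fin 2, t.route (wpt k h x) = x.1) :
    treeIdxPartition k t h = wCanonical k := by
  refine (isIdxPartition_treeIdxPartition k t h ht.le).eq_wCanonical fun S hS x hx y hy => ?_
  simp only [treeIdxPartition, Finset.mem_filter, Finset.mem_image] at hS
  obtain ⟨⟨l, -, rfl⟩, -⟩ := hS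
  simp only [Finset.mem_filter, Finset.mem_univ, true_and, hroute] at hx hy
  exact Fin.ext (hx.trans hy.symm)

theorem route_eq_iff_of_treeIdxPartition_eq {k : ℕ} {t : TDT 2} {h : ℕ → ℝ}
    (ht : treeIdxPartition k t h = wCanonical k) (x y : Fin k × Fin 2) :
    t.route (wpt k h x) = t.route (wpt k h y) ↔ x.1 = y.1 := by
  have hmem : (Finset.univ.filter fun z => t.route (wpt k h z) = t.route (wpt k h x)) ∈
      treeIdxPartition k t h := by
    simp only [treeIdxPartition, Finset.mem_filter, Finset.mem_image, Finset.mem_range]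
    exact ⟨⟨_, t.route_lt_leaves _, rfl⟩, x, by simp⟩
  rw [ht, mem_wCanonical] at hmem
  obtain ⟨i, hi⟩ := hmem
  have hx := Finset.ext_iff.1 hi x
  have hy := Finset.ext_iff.1 hi y
  simp only [Finset.mem_filter, Finset.mem_univ, true_and, true_iff] at hx hy
  rw [hx, eq_comm, hy, eq_comm]

/-- A tree that induces the canonical partition is as deep as possible. -/
theorem le_depth_of_treeIdxPartition_eq {k : ℕ} {t : TDT 2} {h : ℕ → ℝ} (hh : ∀ i, 0 ≤ h i)
    (ht : treeIdxPartition k t h = wCanonical k) : k ≤ t.depth + 1 := by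
  have hlow : ∀ i (h1 : 1 ≤ i) (h2 : i ≤ k),
      lowPt h i = wpt k h (⟨i - 1, by omega⟩, 0) := fun i h1 h2 => by
    simp [wpt_eq, Nat.sub_add_cancel h1]
  have hhigh : ∀ i (h1 : 1 ≤ i) (h2 : i ≤ k),
      highPt h i = wpt k h (⟨i - 1, by omega⟩, 1) := fun i h1 h2 => by
    simp [wpt_eq, Nat.sub_add_cancel h1]
  refine TDT.le_depth_of_separates (lowPt h) (highPt h) (exists_spanning_cluster hh) k t ?_ ?_
  · intro i h1 h2
    rw [hlow i h1 h2, hhigh i h1 h2, route_eq_iff_of_treeIdxPartition_eq ht]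
  · intro i j h1 h2 h3
    rw [hlow i h1 (by omega), hlow j (by omega) h3, ne_eq,
      route_eq_iff_of_treeIdxPartition_eq ht, Fin.mk.injEq]
    omega

theorem treeIdxPartition_caterpillar (m : ℕ) {h : ℕ → ℝ} (hh : ∀ i, 0 ≤ h i)
    (hlarge : ∀ i, 2 ≤ i → 1 < h i) :
    treeIdxPartition (m + 1) (TDT.caterpillar axis (fun j => axisSum h (axis j) j) m) h =
      wCanonical (m + 1) := by
  refine treeIdxPartition_eq_wCanonical (TDT.leaves_caterpillar _ _ _) fun x => ?_
  refine TDT.route_caterpillar _ _ _ _ _ (by omega) (fun _ => ?_) fun j h1 h2 => ?_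
  · rw [wpt_apply_axis]
  · have := wpt_add_le_wpt (m + 1) hh (x := x) (y := (⟨j, by omega⟩, 0)) h1
    dsimp only at this
    linarith [hlarge (j + 1) (by omega)]

/-- STATEMENT: impossibility of shallow explanations in the plane for the weighted
point-set `X(w, h)` and the weighted k-median objective. -/
theorem stmt_9 (k : ℕ) (hk : 3 ≤ k) (p : ℕ → ℕ) :
    ∃ h w : ℕ → ℝ,
      (∀ i, 1 ≤ i → i ≤ k → 0 < h i) ∧ (∀ i, 1 ≤ i → i ≤ k → 0 < w i) ∧
      (∃ t : TDT 2, t.leaves = k ∧ t.depth = k - 1 ∧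
        wCostMedian k h w (treeIdxPartition k t h) = wOptMedian k h w) ∧
      ∀ t : TDT 2, t.leaves = k → t.depth ≤ k - 2 →
        (p (2 * k) : ℝ) * wOptMedian k h w ≤ wCostMedian k h w (treeIdxPartition k t h) := by
  have hk0 : (0 : ℝ) < k := by exact_mod_cast (by omega : 0 < k)
  set M : ℝ := p (2 * k) + 1 with hM
  have hM1 : 1 ≤ M := by simp [hM]
  set B : ℝ := 1 + 4 * k * M with hB
  have hB2 : 2 ≤ B := by
    have : (1 : ℝ) ≤ k := by exact_mod_cast (by omega : 1 ≤ k)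
    nlinarith
  have hB0 : 0 < B := by linarith
  set h : ℕ → ℝ := fun i => B ^ i with hh
  set w : ℕ → ℝ := fun i => (B ^ i)⁻¹ with hw
  have hpos : ∀ i, 0 < h i := fun i => pow_pos hB0 i
  have hwpos : ∀ i, 0 < w i := fun i => inv_pos.2 (hpos i)
  have hh0 : ∀ i, 0 ≤ h i := fun i => (hpos i).le
  have hw0 : ∀ i, 0 ≤ w i := fun i => (hwpos i).le
  have hone : ∀ i, 1 ≤ h i := fun i => one_le_pow₀ (by linarith)
  have htwo : ∀ i, 1 ≤ i → 2 ≤ h i := fun i hi =>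
    hB2.trans (le_self_pow₀ (by linarith) (by omega))
  have hcanon : M * wCostMedian k h w (wCanonical k) ≤ 1 / 2 := by
    have hterm : ∀ i : Fin k,
        w (i + 1) * ‖highPt h (i + 1) - lowPt h (i + 1)‖ ≤ 2 / (4 * k * M) := fun i => by
      rw [le_div_iff₀ (by positivity), hw, inv_mul_eq_div, div_mul_eq_mul_div,
        div_le_iff₀ (hpos _)]
      have h1 := norm_highPt_sub_lowPt_le hh0 (i + 1) (by omega)
      have h2 : ∑ j ∈ Finset.range (i + 1), (h j + 1) ≤
          2 * ∑ j ∈ Finset.range (i + 1), B ^ j := by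
        rw [Finset.mul_sum]
        refine Finset.sum_le_sum fun j _ => ?_
        linarith [hone j, show h j = B ^ j from rfl]
      have h3 := geom_sum_mul B (i + 1)
      have h4 : B - 1 = 4 * k * M := by rw [hB]; ring
      rw [← h4]
      nlinarith
    have hsum := (wCostMedian_wCanonical_le k h w hw0).trans
      (Finset.sum_le_sum fun i _ => hterm i)
    simp only [Finset.sum_const, Finset.card_univ, Fintype.card_fin, nsmul_eq_mul] at hsum
    calc M * wCostMedian k h w (wCanonical k) ≤ M * (k * (2 / (4 * k * M))) := by gcongr
      _ = 1 / 2 := by field_simp; norm_num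
  have hdist : ∀ x y : Fin k × Fin 2, x.1 < y.1 →
      1 / 2 ≤ w (y.1 + 1) * ‖wpt k h x - wpt k h y‖ := fun x y hxy => by
    have h1 := le_norm_wpt_sub k hh0 hxy
    have h2 := htwo (y.1 + 1) (by omega)
    rw [hw, inv_mul_eq_div, le_div_iff₀ (hpos _)]
    linarith [show h (y.1 + 1) = B ^ ((y.1 : ℕ) + 1) from rfl]
  have hw_anti : ∀ i j, i ≤ j → w j ≤ w i := fun i j hij =>
    inv_anti₀ (hpos i) (pow_le_pow_right₀ (by linarith) hij)
  have hother : ∀ P, IsIdxPartition k P → P ≠ wCanonical k →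
      M * wCostMedian k h w (wCanonical k) ≤ wCostMedian k h w P := fun P hP hne => by
    obtain ⟨S, hS, x, hx, y, hy, hxy⟩ : ∃ S ∈ P, ∃ x ∈ S, ∃ y ∈ S, x.1 < y.1 := by
      by_contra! hcon
      exact hne (hP.eq_wCanonical fun S hS x hx y hy =>
        le_antisymm (hcon S hS y hy x hx) (hcon S hS x hx y hy))
    refine hcanon.trans ((hdist x y hxy).trans ?_)
    refine le_wCostMedian_of_mixed k h w hw0 hS hx hy (fun e => hxy.ne (by rw [e])) ?_
    have hlt : (x.1 : ℕ) < y.1 := hxy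
    exact hw_anti _ _ (by omega)
  have hnonneg : 0 ≤ wCostMedian k h w (wCanonical k) :=
    Finset.sum_nonneg fun S _ => Real.iInf_nonneg fun c => Finset.sum_nonneg fun x _ =>
      mul_nonneg (hw0 _) (norm_nonneg _)
  have hopt : wOptMedian k h w = wCostMedian k h w (wCanonical k) := by
    refine IsLeast.csInf_eq ⟨⟨_, isIdxPartition_wCanonical k, rfl⟩, ?_⟩
    rintro _ ⟨P, hP, rfl⟩
    by_cases hne : P = wCanonical k
    · rw [hne]
    · exact (le_mul_of_one_le_left hnonneg hM1).trans (hother P hP hne)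
  refine ⟨h, w, fun i _ _ => hpos i, fun i _ _ => hwpos i, ?_, fun t ht hdepth => ?_⟩
  · obtain ⟨m, rfl⟩ : ∃ m, k = m + 1 := ⟨k - 1, by omega⟩
    refine ⟨_, TDT.leaves_caterpillar axis (fun j => axisSum h (axis j) j) m,
      TDT.depth_caterpillar _ _ _, ?_⟩
    rw [hopt, treeIdxPartition_caterpillar m hh0 fun i hi => by linarith [htwo i (by omega)]]
  · have hne : treeIdxPartition k t h ≠ wCanonical k := fun e => by
      have := le_depth_of_treeIdxPartition_eq hh0 e
      omega
    rw [hopt]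
    refine le_trans ?_ (hother _ (isIdxPartition_treeIdxPartition k t h ht.le) hne)
    exact mul_le_mul_of_nonneg_right (by linarith) hnonneg

end
end
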